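/- arXiv:2502.16004 — 2 statements merged into one kernel-verified Lean document; each statement's English description precedes it below -/
import Mathlib

section
/- A commutative Noetherian local ring R is Gorenstein if and only if there exists a nonzero finitely generated R-module M such that inj.dim_R(M) < ∞, B(M) < ∞, and Ext^i_R(M,R) = 0 for i ≫ 0. -/
/-!
STATEMENT 9: A commutative Noetherian local ring `R` is Gorenstein if and only if there
exists a nonzero finitely generated `R`-module `M` such that `inj.dim_R(M) < ∞`,
`B(M) < ∞` (the Auslander bound), and `Ext^i_R(M,R) = 0` for `i ≫ 0`.
-/

open CategoryTheory

/-- `Ext^n_R(M, N)` as an `R`-module, via the derived functor `Ext` of Mathlib. -/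
noncomputable def extRMod (R : Type) [CommRing R] (M N : ModuleCat R) (n : ℕ) : ModuleCat R :=
  ((Ext R (ModuleCat R) n).obj (Opposite.op M)).obj N

/-- Vanishing of `Ext^n_R(M, N)`. -/
def extVanish (R : Type) [CommRing R] (M N : ModuleCat R) (n : ℕ) : Prop :=
  Subsingleton (extRMod R M N n)

/-- `M` has injective dimension at most `n`: `Ext^i(N, M) = 0` for every module `N` and
every `i > n`. -/
def injDimLE (R : Type) [CommRing R] (M : ModuleCat R) (n : ℕ) : Prop :=
  ∀ (N : ModuleCat R) (i : ℕ), n < i → extVanish R N M i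

/-- `M` has projective dimension at most `n`: `Ext^i(M, N) = 0` for every module `N` and
every `i > n`. -/
def projDimLE (R : Type) [CommRing R] (M : ModuleCat R) (n : ℕ) : Prop :=
  ∀ (N : ModuleCat R) (i : ℕ), n < i → extVanish R M N i

/-- A commutative Noetherian local ring is Gorenstein if it has finite injective dimension
as a module over itself. -/
def IsGorensteinRing (R : Type) [CommRing R] : Prop :=
  ∃ n : ℕ, injDimLE R (ModuleCat.of R R) n

/-- `P R M N = sup { n : Ext^n_R(M,N) ≠ 0 }`, as an extended natural number
(`0` if the set is empty, `⊤` if it is unbounded). -/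
noncomputable def extSup (R : Type) [CommRing R] (M N : ModuleCat R) : ℕ∞ :=
  sSup {c : ℕ∞ | ∃ n : ℕ, c = n ∧ ¬ extVanish R M N n}

/-- The Auslander bound of `M`:
`B(M) = sup { P(M,N) : N finitely generated nonzero with P(M,N) < ∞ }`. -/
noncomputable def auslanderBound (R : Type) [CommRing R] (M : ModuleCat R) : ℕ∞ :=
  sSup {c : ℕ∞ | ∃ N : ModuleCat R, Module.Finite R N ∧ Nontrivial N ∧
    extSup R M N ≠ ⊤ ∧ c = extSup R M N}

universe u

open CategoryTheory.Abelian

theorem extVanish_succ_iff (R : Type) [CommRing R] (M N : ModuleCat R) (n : ℕ) :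
    extVanish R M N (n + 1) ↔ Subsingleton (Abelian.Ext M N (n + 1)) := by
  let P := projectiveResolution M
  rw [extVanish, extRMod, ← ModuleCat.isZero_iff_subsingleton,
    (P.isoExt (R := R) (n + 1) N).isZero_iff, ← HomologicalComplex.exactAt_iff_isZero_homology,
    HomologicalComplex.exactAt_iff' _ n (n + 1) (n + 2) (by simp) (by simp),
    ShortComplex.moduleCat_exact_iff]
  constructor
  · intro h
    refine ⟨fun a b ↦ ?_⟩
    suffices H : ∀ a : Abelian.Ext M N (n + 1), a = 0 by rw [H a, H b]
    intro a
    obtain ⟨f, hf, rfl⟩ := P.extMk_surjective a (n + 2) rfl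
    rw [P.extMk_eq_zero_iff _ _ _ _ n rfl]
    exact h f hf
  · intro h f hf
    exact (P.extMk_eq_zero_iff f (n + 2) rfl hf n rfl).1 (Subsingleton.elim _ _)

theorem extVanish_iff_of_pos (R : Type) [CommRing R] (M N : ModuleCat R) {n : ℕ} (hn : 0 < n) :
    extVanish R M N n ↔ Subsingleton (Abelian.Ext M N n) := by
  obtain ⟨n, rfl⟩ := Nat.exists_eq_succ_of_ne_zero hn.ne'
  exact extVanish_succ_iff R M N n

theorem injDimLE_iff (R : Type) [CommRing R] (M : ModuleCat R) (n : ℕ) :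
    injDimLE R M n ↔ HasInjectiveDimensionLE M n := by
  rw [HasInjectiveDimensionLE, hasInjectiveDimensionLT_iff]
  constructor
  · intro h i hi Y e
    have := (extVanish_iff_of_pos R Y M (by lia)).1 (h Y i (by lia))
    exact Subsingleton.elim _ _
  · intro h Y i hi
    rw [extVanish_iff_of_pos R Y M (by lia)]
    exact subsingleton_of_forall_eq 0 fun e ↦ h i (by lia) e

theorem extSup_le_iff (R : Type) [CommRing R] (M N : ModuleCat R) (n : ℕ) :
    extSup R M N ≤ n ↔ ∀ i, n < i → Subsingleton (Abelian.Ext M N i) := by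
  rw [extSup, sSup_le_iff]
  constructor
  · intro h i hi
    rw [← extVanish_iff_of_pos R M N (by lia)]
    by_contra hv
    exact absurd (Nat.cast_le.1 (h i ⟨i, rfl, hv⟩)) (by lia)
  · rintro h _ ⟨i, rfl, hv⟩
    by_contra hi
    rw [Nat.cast_le, not_le] at hi
    exact hv ((extVanish_iff_of_pos R M N (by lia)).2 (h i hi))

section FreeModules

variable {R : Type u} [CommRing R]

/-- The free module of rank `b`. -/
abbrev freeModuleCat (R : Type u) [CommRing R] (b : ℕ) : ModuleCat.{u} R :=
  ModuleCat.of R (Fin b → R)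

/-- The `j`-th coordinate of a free module. -/
def freeProj (R : Type u) [CommRing R] {b : ℕ} (j : Fin b) :
    freeModuleCat R b ⟶ ModuleCat.of R R :=
  ModuleCat.ofHom (LinearMap.proj j)

/-- The inclusion of the `j`-th summand of a free module. -/
def freeIncl (R : Type u) [CommRing R] {b : ℕ} (j : Fin b) :
    ModuleCat.of R R ⟶ freeModuleCat R b :=
  ModuleCat.ofHom (LinearMap.single R (fun _ ↦ R) j)

theorem freeIncl_comp_freeProj_self {b : ℕ} (j : Fin b) :
    freeIncl R j ≫ freeProj R j = 𝟙 _ := by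
  ext
  simp [freeIncl, freeProj]

theorem freeIncl_comp_freeProj_of_ne {b : ℕ} {i j : Fin b} (h : i ≠ j) :
    freeIncl R i ≫ freeProj R j = 0 := by
  ext
  simp [freeIncl, freeProj, h.symm]

theorem sum_freeProj_comp_freeIncl (b : ℕ) :
    ∑ j : Fin b, freeProj R j ≫ freeIncl R j = 𝟙 _ := by
  refine ModuleCat.hom_ext (LinearMap.ext fun x ↦ ?_)
  rw [ModuleCat.hom_sum, LinearMap.sum_apply]
  simpa [freeIncl, freeProj] using Finset.univ_sum_single x

theorem eq_sum_smul_freeProj {b : ℕ} (f : freeModuleCat R b ⟶ ModuleCat.of R R) :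
    f = ∑ j, f.hom (Pi.single j 1) • freeProj R j := by
  refine ModuleCat.hom_ext (LinearMap.pi_ext' fun j ↦ LinearMap.ext_ring ?_)
  simp [ModuleCat.hom_sum, freeProj, Pi.single_apply]

theorem CategoryTheory.Abelian.Ext.eq_sum_freeProj_freeIncl {X : ModuleCat.{u} R} {b i : ℕ}
    (α : Abelian.Ext X (freeModuleCat R b) i) :
    α = ∑ j : Fin b, (α.comp (Ext.mk₀ (freeProj R j)) (add_zero i)).comp
      (Ext.mk₀ (freeIncl R j)) (add_zero i) := by
  conv_lhs => rw [← α.comp_mk₀_id, ← sum_freeProj_comp_freeIncl, Ext.mk₀_sum, Ext.comp_sum]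
  refine Finset.sum_congr rfl fun j _ ↦ ?_
  rw [Ext.comp_assoc_of_third_deg_zero, Ext.mk₀_comp_mk₀]

theorem subsingleton_ext_freeModuleCat {X : ModuleCat.{u} R} {i : ℕ} (b : ℕ)
    [Subsingleton (Abelian.Ext X (ModuleCat.of R R) i)] :
    Subsingleton (Abelian.Ext X (freeModuleCat R b) i) := by
  refine subsingleton_of_forall_eq 0 fun α ↦ ?_
  rw [α.eq_sum_freeProj_freeIncl]
  refine Finset.sum_eq_zero fun j _ ↦ ?_
  rw [Subsingleton.elim (α.comp _ _) 0, Ext.zero_comp]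

/-- The short exact sequence `0 → ker f → Rᵇ → M → 0`. -/
theorem exists_shortExact_freeModuleCat [IsNoetherianRing R] (M : ModuleCat.{u} R)
    [Module.Finite R M] :
    ∃ (K : ModuleCat.{u} R) (b : ℕ) (f : K ⟶ freeModuleCat R b) (g : freeModuleCat R b ⟶ M)
      (w : f ≫ g = 0), (ShortComplex.mk f g w).ShortExact ∧ Module.Finite R K := by
  obtain ⟨b, f, hf⟩ := Module.Finite.exists_fin' R M
  exact ⟨_, b, _, _, _, LinearMap.shortExact_shortComplexKer hf,
    inferInstanceAs (Module.Finite R f.ker)⟩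

end FreeModules

section LongExactSequences

variable {C : Type*} [Category C] [Abelian C] [HasExt C] {S : ShortComplex C}

theorem CategoryTheory.ShortComplex.ShortExact.subsingleton_ext_right_X₁ (hS : S.ShortExact)
    (X : C) (n : ℕ) [Subsingleton (Abelian.Ext X S.X₃ n)]
    [Subsingleton (Abelian.Ext X S.X₂ (n + 1))] :
    Subsingleton (Abelian.Ext X S.X₁ (n + 1)) := by
  refine subsingleton_of_forall_eq 0 fun x ↦ ?_
  obtain ⟨y, rfl⟩ := Ext.covariant_sequence_exact₁ X hS x (Subsingleton.elim _ _) rfl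
  rw [Subsingleton.elim y 0, Ext.zero_comp]

theorem CategoryTheory.ShortComplex.ShortExact.subsingleton_ext_left_X₁ (hS : S.ShortExact)
    (Y : C) (n : ℕ) [Subsingleton (Abelian.Ext S.X₂ Y n)]
    [Subsingleton (Abelian.Ext S.X₃ Y (n + 1))] :
    Subsingleton (Abelian.Ext S.X₁ Y n) := by
  refine subsingleton_of_forall_eq 0 fun x ↦ ?_
  obtain ⟨y, rfl⟩ := Ext.contravariant_sequence_exact₁ hS Y x (add_comm 1 n)
    (Subsingleton.elim _ _)
  rw [Subsingleton.elim y 0, Ext.comp_zero]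

theorem CategoryTheory.ShortComplex.ShortExact.subsingleton_ext_left_X₂ (hS : S.ShortExact)
    (Y : C) (n : ℕ) [Subsingleton (Abelian.Ext S.X₁ Y n)]
    [Subsingleton (Abelian.Ext S.X₃ Y n)] :
    Subsingleton (Abelian.Ext S.X₂ Y n) := by
  refine subsingleton_of_forall_eq 0 fun x ↦ ?_
  obtain ⟨y, rfl⟩ := Ext.contravariant_sequence_exact₂ hS Y x (Subsingleton.elim _ _)
  rw [Subsingleton.elim y 0, Ext.comp_zero]

end LongExactSequences

section ProjectiveDimension

variable {R : Type u} [CommRing R] [IsNoetherianRing R]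

/-- If a class `P` of modules contains the kernels of surjections from finite free modules onto
its members, and `Ext^{j+1}(K, -)` vanishes on the finite members of `P`, then the projective
dimension of every finite member `K` of `P` is at most `j`. -/
theorem hasProjectiveDimensionLE_of_subsingleton_ext (P : ModuleCat.{u} R → Prop)
    (hP : ∀ (K : ModuleCat.{u} R) (b : ℕ) (f : K ⟶ freeModuleCat R b) (L : ModuleCat.{u} R)
      (g : freeModuleCat R b ⟶ L) (w : f ≫ g = 0), (ShortComplex.mk f g w).ShortExact →
        P L → P K)
    (j : ℕ) (K : ModuleCat.{u} R) [Module.Finite R K] (hK : P K)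
    (h : ∀ Y : ModuleCat.{u} R, Module.Finite R Y → P Y →
      Subsingleton (Abelian.Ext K Y (j + 1))) :
    HasProjectiveDimensionLE K j := by
  obtain ⟨L, b, f, g, w, hS, hL⟩ := exists_shortExact_freeModuleCat K
  have hPL := hP L b f K g w hS hK
  induction j generalizing K L b with
  | zero =>
    have := h L hL hPL
    have hsplit : IsSplitEpi g := by
      obtain ⟨s, hs⟩ := Ext.covariant_sequence_exact₃ K hS (Ext.mk₀ (𝟙 K)) (zero_add 1)
        (Subsingleton.elim (α := Abelian.Ext K L 1) _ _)
      obtain ⟨s, rfl⟩ := (Ext.mk₀_bijective K (freeModuleCat R b)).2 s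
      rw [Ext.mk₀_comp_mk₀] at hs
      exact ⟨⟨s, (Ext.mk₀_bijective K K).1 hs⟩⟩
    have : Projective K := (Retract.mk (section_ g) g).projective
    infer_instance
  | succ j ih =>
    obtain ⟨L', b', f', g', w', hS', hL'⟩ := exists_shortExact_freeModuleCat L
    have := ih L hPL (fun Y hY hPY ↦ by
      have := h Y hY hPY
      have : Subsingleton (Abelian.Ext (freeModuleCat R b) Y (j + 1)) :=
        subsingleton_of_forall_eq 0 fun e ↦ e.eq_zero_of_projective
      exact hS.subsingleton_ext_left_X₁ Y (j + 1)) L' b' f' g' w' hS' hL'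
        (hP L' b' f' L g' w' hS' hPL)
    exact hS.hasProjectiveDimensionLT_X₃ (j + 1) this inferInstance

end ProjectiveDimension

section InjectiveDimension

variable {R : Type u} [CommRing R]

/-- The exact sequence `0 → R/J → R/I → R/(I + (x)) → 0` for `J = (I : x)`, where the first map is
the multiplication by `x`. -/
noncomputable def colonShortComplex (I : Ideal R) (x : R) (J : Ideal R)
    (hJ : J = Submodule.comap (LinearMap.mulLeft R x) I) : ShortComplex (ModuleCat.{u} R) where
  X₁ := ModuleCat.of R (R ⧸ J)
  X₂ := ModuleCat.of R (R ⧸ I)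
  X₃ := ModuleCat.of R (R ⧸ (I ⊔ Ideal.span {x}))
  f := ModuleCat.ofHom (Submodule.mapQ J I (LinearMap.mulLeft R x) hJ.le)
  g := ModuleCat.ofHom (Submodule.factor le_sup_left)
  zero := by
    rw [← ModuleCat.ofHom_comp]
    refine ModuleCat.hom_ext (Submodule.linearMap_qext _ (LinearMap.ext fun y ↦ ?_))
    refine (Submodule.Quotient.mk_eq_zero _).2 (Ideal.mem_sup_right ?_)
    exact Ideal.mul_mem_right _ _ (Ideal.mem_span_singleton_self x)

theorem colonShortComplex_shortExact (I : Ideal R) (x : R) (J : Ideal R)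
    (hJ : J = Submodule.comap (LinearMap.mulLeft R x) I) :
    (colonShortComplex I x J hJ).ShortExact := by
  refine ModuleCat.shortComplex_shortExact _ ?_ ?_ ?_
  · rintro ⟨y⟩
    constructor
    · intro h
      obtain ⟨a, ha, b, hb, hab⟩ := Submodule.mem_sup.1 ((Submodule.Quotient.mk_eq_zero _).1 h)
      obtain ⟨c, rfl⟩ := Ideal.mem_span_singleton'.1 hb
      refine ⟨Submodule.Quotient.mk c, (Submodule.Quotient.eq _).2 ?_⟩
      rw [show y = a + c * x from hab.symm, LinearMap.mulLeft_apply, mul_comm,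
        sub_add_cancel_right]
      exact neg_mem ha
    · rintro ⟨c, hc⟩
      rw [← hc, ← ConcreteCategory.comp_apply, (colonShortComplex I x J hJ).zero]
      rfl
  · refine LinearMap.ker_eq_bot.1 ?_
    refine (Submodule.ker_mapQ _ _ _ hJ.le).trans ?_
    rw [← hJ, Submodule.mkQ_map_self]
    rfl
  · exact Submodule.factor_surjective (le_sup_left : I ≤ I ⊔ Ideal.span {x})

/-- Baer's criterion for the injective dimension. -/
theorem hasInjectiveDimensionLE_of_subsingleton_ext_quotient (X : ModuleCat.{u} R) (s : ℕ)
    (h : ∀ I : Ideal R, Subsingleton (Abelian.Ext (ModuleCat.of R (R ⧸ I)) X (s + 1))) :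
    HasInjectiveDimensionLE X s := by
  induction s generalizing X with
  | zero =>
    have hbaer : Module.Baer R X := fun I g ↦ by
      let S : ShortComplex (ModuleCat.{u} R) := ShortComplex.mk (ModuleCat.ofHom I.subtype)
        (ModuleCat.ofHom I.mkQ) (by
          ext x
          exact Ideal.Quotient.eq_zero_iff_mem.2 x.2)
      have hS : S.ShortExact := ModuleCat.shortComplex_shortExact S
        (LinearMap.exact_subtype_mkQ I) I.subtype_injective I.mkQ_surjective
      have : Subsingleton (Abelian.Ext S.X₃ X 1) := h I
      obtain ⟨e, he⟩ := Ext.contravariant_sequence_exact₁ hS X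
        (Ext.mk₀ (X := S.X₁) (ModuleCat.ofHom g)) (add_zero 1) (Subsingleton.elim _ _)
      obtain ⟨e, rfl⟩ := (Ext.mk₀_bijective _ _).2 e
      rw [Ext.mk₀_comp_mk₀] at he
      have he := (Ext.mk₀_bijective _ _).1 he
      exact ⟨e.hom, fun x hx ↦ DFunLike.congr_fun (congrArg ModuleCat.Hom.hom he) ⟨x, hx⟩⟩
    have := hbaer.injective
    have : Injective X := Module.injective_object_of_injective_module R X
    infer_instance
  | succ s ih =>
    obtain ⟨J, _, f, _⟩ := EnoughInjectives.presentation X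
    let S := ShortComplex.mk f (Limits.cokernel.π f) (by simp)
    have hS : S.ShortExact := { exact := ShortComplex.exact_cokernel f }
    have : HasInjectiveDimensionLE S.X₃ s := ih _ fun I ↦ by
      refine subsingleton_of_forall_eq 0 fun e ↦ ?_
      obtain ⟨y, rfl⟩ := Ext.covariant_sequence_exact₃ _ hS e rfl
        ((h I).elim _ _)
      rw [Ext.eq_zero_of_injective y, Ext.zero_comp]
    exact (hS.hasInjectiveDimensionLT_X₃_iff s ‹_›).1 this

variable [IsNoetherianRing R] [IsLocalRing R]

/-- If `Ext^i(k, X)` vanishes for `i > s`, then so does `Ext^i(R/I, X)` for every ideal `I`. -/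
theorem subsingleton_ext_quotient_of_residueField (X : ModuleCat.{u} R) [Module.Finite R X] (s : ℕ)
    (h : ∀ i, s < i → Subsingleton
      (Abelian.Ext (ModuleCat.of R (R ⧸ IsLocalRing.maximalIdeal R)) X i)) (I : Ideal R) :
    ∀ i, s < i → Subsingleton (Abelian.Ext (ModuleCat.of R (R ⧸ I)) X i) := by
  induction I using WellFoundedGT.induction with
  | ind I ih =>
    intro i hi
    by_cases htop : I = ⊤
    · have : Subsingleton (R ⧸ I) := Ideal.Quotient.subsingleton_iff.2 htop
      have hz : Limits.IsZero (ModuleCat.of R (R ⧸ I)) := ModuleCat.isZero_of_subsingleton _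
      refine subsingleton_of_forall_eq 0 fun e ↦ ?_
      rw [← Ext.mk₀_id_comp e, hz.eq_of_src (𝟙 _) 0, Ext.mk₀_zero, Ext.zero_comp]
    by_cases hmax : I = IsLocalRing.maximalIdeal R
    · subst hmax
      exact h i hi
    by_cases hprime : I.IsPrime
    · obtain ⟨x, hx, hxI⟩ := SetLike.exists_of_lt
        (lt_of_le_of_ne (IsLocalRing.le_maximalIdeal htop) hmax)
      have hcolon : I = Submodule.comap (LinearMap.mulLeft R x) I := by
        ext y
        exact ⟨fun hy ↦ I.mul_mem_left x hy, fun hy ↦ (hprime.mem_or_mem hy).resolve_left hxI⟩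
      have hS := colonShortComplex_shortExact I x I hcolon
      have hf : (colonShortComplex I x I hcolon).f = x • 𝟙 (ModuleCat.of R (R ⧸ I)) :=
        ModuleCat.hom_ext (Submodule.linearMap_qext _ (LinearMap.ext fun y ↦ rfl))
      have : Subsingleton (Abelian.Ext (colonShortComplex I x I hcolon).X₃ X (i + 1)) := by
        refine ih _ (lt_of_le_of_ne le_sup_left fun h ↦ hxI ?_) (i + 1) (by lia)
        rw [h]
        exact Ideal.mem_sup_right (Ideal.mem_span_singleton_self x)
      have key : (⊤ : Submodule R (Abelian.Ext (ModuleCat.of R (R ⧸ I)) X i)) ≤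
          IsLocalRing.maximalIdeal R • ⊤ := by
        intro e _
        obtain ⟨e', rfl⟩ : ∃ e' : Abelian.Ext (ModuleCat.of R (R ⧸ I)) X i,
            (Ext.mk₀ (x • 𝟙 (ModuleCat.of R (R ⧸ I)))).comp e' (zero_add i) = e := by
          rw [← hf]
          exact Ext.contravariant_sequence_exact₁ hS X e (add_comm 1 i) (Subsingleton.elim _ _)
        rw [Ext.mk₀_smul, Ext.smul_comp, Ext.mk₀_id_comp]
        exact Submodule.smul_mem_smul hx trivial
      rw [← Submodule.subsingleton_iff R, ← subsingleton_iff_bot_eq_top, eq_comm]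
      exact Submodule.eq_bot_of_le_smul_of_le_jacobson_bot _ _ Module.Finite.fg_top key
        (IsLocalRing.jacobson_eq_maximalIdeal ⊥ bot_ne_top).ge
    · obtain ⟨a, ha, b, hb, hab⟩ := (Ideal.not_isPrime_iff.1 hprime).resolve_left htop
      have hS := colonShortComplex_shortExact I a _ rfl
      have : Subsingleton (Abelian.Ext (colonShortComplex I a _ rfl).X₁ X i) := by
        refine ih _ (lt_of_le_of_ne (fun y hy ↦ I.mul_mem_left a hy) fun h ↦ hb ?_) i hi
        rw [h]
        exact hab
      have : Subsingleton (Abelian.Ext (colonShortComplex I a _ rfl).X₃ X i) := by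
        refine ih _ (lt_of_le_of_ne le_sup_left fun h ↦ ha ?_) i hi
        rw [h]
        exact Ideal.mem_sup_right (Ideal.mem_span_singleton_self a)
      exact hS.subsingleton_ext_left_X₂ X i

end InjectiveDimension

section MinimalCover

variable {R : Type u} [CommRing R] [IsNoetherianRing R] [IsLocalRing R]

open scoped TensorProduct in
/-- The beginning `0 → K → Rᵇ → M → 0` of a minimal free resolution. -/
theorem exists_shortExact_minimal (M : ModuleCat.{u} R) [Module.Finite R M] [Nontrivial M] :
    ∃ (K : ModuleCat.{u} R) (b : ℕ) (f : K ⟶ freeModuleCat R b) (g : freeModuleCat R b ⟶ M)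
      (w : f ≫ g = 0), (ShortComplex.mk f g w).ShortExact ∧ Module.Finite R K ∧ 0 < b ∧
        ∀ (j : Fin b) (y : K), (f ≫ freeProj R j).hom y ∈ IsLocalRing.maximalIdeal R := by
  have : Module.Free (IsLocalRing.ResidueField R) (IsLocalRing.ResidueField R ⊗[R] M) :=
    Module.Free.of_divisionRing _ _
  let B := Module.finBasis (IsLocalRing.ResidueField R) (IsLocalRing.ResidueField R ⊗[R] M)
  have hlift (j) : ∃ v : M, (1 : IsLocalRing.ResidueField R) ⊗ₜ[R] v = B j :=
    TensorProduct.mk_surjective R M _ Ideal.Quotient.mk_surjective (B j)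
  choose v hv using hlift
  have hspan := IsLocalRing.span_eq_top_of_tmul_eq_basis v B hv
  let φ := Fintype.linearCombination R v
  have hφ : Function.Surjective φ := by
    rw [← LinearMap.range_eq_top, Fintype.range_linearCombination, hspan]
  refine ⟨_, _, _, _, _, LinearMap.shortExact_shortComplexKer hφ,
    inferInstanceAs (Module.Finite R φ.ker), ?_, fun j y ↦ ?_⟩
  · rw [Nat.pos_iff_ne_zero]
    intro h
    rw [Module.finrank_eq_zero_iff_of_free, IsLocalRing.subsingleton_tensorProduct] at h
    exact not_subsingleton M h
  · have hy : φ y.1 = 0 := y.2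
    have hsum : ∑ i, IsLocalRing.residue R (y.1 i) • B i = 0 := by
      have := congrArg (fun m ↦ (1 : IsLocalRing.ResidueField R) ⊗ₜ[R] m) hy
      simp only [φ, Fintype.linearCombination_apply, TensorProduct.tmul_sum,
        TensorProduct.tmul_smul, hv, TensorProduct.tmul_zero] at this
      rw [← this]
      exact Finset.sum_congr rfl fun i _ ↦ algebraMap_smul _ _ _
    rw [← IsLocalRing.residue_eq_zero_iff]
    exact Fintype.linearIndependent_iff.1 B.linearIndependent _ hsum j

end MinimalCover

section SocleModels

open CategoryTheory.Limits CategoryTheory.Pretriangulated DerivedCategory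
open CochainComplex hiding singleFunctor singleFunctors

attribute [local instance] Abelian.hasFiniteBiproducts

section KInjectiveComplexes

variable {C : Type*} [Category C] [Abelian C]

theorem CochainComplex.isKInjective_mappingCone {K L : CochainComplex C ℤ} (f : K ⟶ L)
    [K.IsKInjective] [L.IsKInjective] : (mappingCone f).IsKInjective := by
  rw [isKInjective_iff_rightOrthogonal]
  exact ObjectProperty.ext_of_isTriangulatedClosed₃ _ _
    (HomotopyCategory.mappingCone_triangleh_distinguished f)
    (IsKInjective.rightOrthogonal K) (IsKInjective.rightOrthogonal L)

theorem CochainComplex.isKInjective_biproduct {ι : Type} [Finite ι]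
    (L : ι → CochainComplex C ℤ) [∀ i, (L i).IsKInjective] : (⨁ L).IsKInjective where
  nonempty_homotopy_zero {K} f hK := by
    have := Fintype.ofFinite ι
    refine ⟨HomotopyCategory.homotopyOfEq _ _ ?_⟩
    rw [← Category.comp_id f, ← biproduct.total, Preadditive.comp_sum, Functor.map_sum,
      Functor.map_zero]
    refine Finset.sum_eq_zero fun i _ ↦ ?_
    rw [← Category.assoc, Functor.map_comp, HomotopyCategory.eq_of_homotopy _ _
      (IsKInjective.homotopyZero (f ≫ biproduct.π L i) hK), Functor.map_zero, zero_comp]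

theorem DerivedCategory.Q_map_surjective_of_isKInjective [HasDerivedCategory C]
    (K L : CochainComplex C ℤ) [L.IsKInjective] :
    Function.Surjective (Q.map : (K ⟶ L) → (Q.obj K ⟶ Q.obj L)) := by
  intro β
  obtain ⟨v, hv⟩ := (IsKInjective.Qh_map_bijective _ L).surjective
    ((quotientCompQhIso C).hom.app K ≫ β ≫ (quotientCompQhIso C).inv.app L)
  obtain ⟨u, rfl⟩ := (HomotopyCategory.quotient C (.up ℤ)).map_surjective v
  refine ⟨u, ?_⟩
  rw [← cancel_epi ((quotientCompQhIso C).hom.app K), ← (quotientCompQhIso C).hom.naturality]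
  simp [hv]

end KInjectiveComplexes

/-- The linear form on `Rᵇ` with coefficients `c` as a morphism `Jᵇ ⟶ J`. -/
noncomputable def linearForm {R : Type u} [CommRing R]
    (J : CochainComplex (ModuleCat.{u} R) ℤ) (b : ℕ) :
    (freeModuleCat R b ⟶ ModuleCat.of R R) →ₗ[R] ((⨁ fun _ : Fin b ↦ J) ⟶ J) where
  toFun f := ∑ j, f.hom (Pi.single j 1) • biproduct.π (fun _ : Fin b ↦ J) j
  map_add' f g := by simp [add_smul, Finset.sum_add_distrib]
  map_smul' r f := by simp [mul_smul, Finset.smul_sum]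

theorem comp_linearForm_f_eq_zero {R : Type u} [CommRing R] {𝔪 : Ideal R}
    {J : CochainComplex (ModuleCat.{u} R) ℤ} {b : ℕ} {f : freeModuleCat R b ⟶ ModuleCat.of R R}
    (hf : ∀ j : Fin b, f.hom (Pi.single j 1) ∈ 𝔪) {X : ModuleCat.{u} R} {p : ℤ}
    (v : X ⟶ (⨁ fun _ : Fin b ↦ J).X p) (hv : ∀ r ∈ 𝔪, r • v = 0) :
    v ≫ (linearForm J b f).f p = 0 := by
  have h : (linearForm J b f).f p =
      ∑ j : Fin b, f.hom (Pi.single j 1) • (biproduct.π (fun _ : Fin b ↦ J) j).f p :=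
    (HomologicalComplex.eval _ _ p).map_sum _ _
  rw [h, Preadditive.comp_sum]
  refine Finset.sum_eq_zero fun j _ ↦ ?_
  rw [Linear.comp_smul, ← Linear.smul_comp, hv _ (hf j), zero_comp]

variable {R : Type u} [CommRing R] (𝔪 : Ideal R) [HasDerivedCategory (ModuleCat.{u} R)]
  {J : CochainComplex (ModuleCat.{u} R) ℤ}
  (ρ : (singleFunctor (ModuleCat.{u} R) 0).obj (ModuleCat.of R R) ≅ Q.obj J)

/-- A K-injective complex isomorphic to the module `N` in the derived category, together with a
linear lift of the linear forms on `N` to morphisms of complexes to a fixed model `J` of `R`, in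
such a way that the linear forms with values in `𝔪` lift to morphisms which vanish on the
elements annihilated by `𝔪`. -/
structure SocleModel (N : ModuleCat.{u} R) where
  /-- the K-injective complex -/
  T : CochainComplex (ModuleCat.{u} R) ℤ
  isKInjective : T.IsKInjective
  /-- the isomorphism in the derived category -/
  φ : (singleFunctor (ModuleCat.{u} R) 0).obj N ≅ Q.obj T
  /-- the lift of linear forms -/
  L : (N ⟶ ModuleCat.of R R) →ₗ[R] (T ⟶ J)
  comm (f : N ⟶ ModuleCat.of R R) :
    φ.hom ≫ Q.map (L f) = (singleFunctor (ModuleCat.{u} R) 0).map f ≫ ρ.hom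
  comp_eq_zero (f : N ⟶ ModuleCat.of R R) (hf : ∀ y, f.hom y ∈ 𝔪) {X : ModuleCat.{u} R} {p : ℤ}
    (v : X ⟶ T.X p) (hv : ∀ r ∈ 𝔪, r • v = 0) : v ≫ (L f).f p = 0

/-- The model of the zero module. -/
noncomputable def SocleModel.ofIsZero {N : ModuleCat.{u} R} (hN : IsZero N) :
    SocleModel 𝔪 ρ N where
  T := HomologicalComplex.zero
  isKInjective := ⟨fun f _ ↦ ⟨Homotopy.ofEq (HomologicalComplex.isZero_zero.eq_of_tgt _ _)⟩⟩
  φ := (Functor.map_isZero _ hN).iso (Functor.map_isZero Q HomologicalComplex.isZero_zero)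
  L := 0
  comm f := (Functor.map_isZero _ hN).eq_of_src _ _
  comp_eq_zero f _ X p v _ := by simp

namespace SocleModel

/-- The morphism in the derived category from `Rᵇ` to `Jᵇ`. -/
noncomputable def freeHom (b : ℕ) : (singleFunctor (ModuleCat.{u} R) 0).obj (freeModuleCat R b) ⟶
    Q.obj (⨁ fun _ : Fin b ↦ J) :=
  ∑ j, (singleFunctor (ModuleCat.{u} R) 0).map (freeProj R j) ≫ ρ.hom ≫
    Q.map (biproduct.ι (fun _ : Fin b ↦ J) j)

theorem freeHom_comp_π {b : ℕ} (j : Fin b) :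
    freeHom ρ b ≫ Q.map (biproduct.π (fun _ : Fin b ↦ J) j) =
      (singleFunctor (ModuleCat.{u} R) 0).map (freeProj R j) ≫ ρ.hom := by
  rw [freeHom, Preadditive.sum_comp, Finset.sum_eq_single j]
  · simp [← Functor.map_comp]
  · intro i _ hij
    simp [← Functor.map_comp, biproduct.ι_π_ne _ hij]
  · simp

theorem freeIncl_comp_freeHom {b : ℕ} (j : Fin b) :
    (singleFunctor (ModuleCat.{u} R) 0).map (freeIncl R j) ≫ freeHom ρ b =
      ρ.hom ≫ Q.map (biproduct.ι (fun _ : Fin b ↦ J) j) := by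
  rw [freeHom, Preadditive.comp_sum, Finset.sum_eq_single j]
  · rw [← Functor.map_comp_assoc, freeIncl_comp_freeProj_self, CategoryTheory.Functor.map_id,
      Category.id_comp]
  · intro i _ hij
    rw [← Functor.map_comp_assoc, freeIncl_comp_freeProj_of_ne hij.symm, Functor.map_zero,
      zero_comp]
  · simp

/-- The isomorphism in the derived category between `Rᵇ` and `Jᵇ`. -/
noncomputable def freeIso (b : ℕ) : (singleFunctor (ModuleCat.{u} R) 0).obj (freeModuleCat R b) ≅
    Q.obj (⨁ fun _ : Fin b ↦ J) where
  hom := freeHom ρ b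
  inv := ∑ j, Q.map (biproduct.π (fun _ : Fin b ↦ J) j) ≫ ρ.inv ≫
    (singleFunctor (ModuleCat.{u} R) 0).map (freeIncl R j)
  hom_inv_id := by
    rw [Preadditive.comp_sum, ← CategoryTheory.Functor.map_id, ← sum_freeProj_comp_freeIncl,
      Functor.map_sum]
    refine Finset.sum_congr rfl fun j _ ↦ ?_
    rw [← Category.assoc, freeHom_comp_π, Category.assoc, Iso.hom_inv_id_assoc, Functor.map_comp]
  inv_hom_id := by
    rw [Preadditive.sum_comp, ← CategoryTheory.Functor.map_id, ← biproduct.total, Functor.map_sum]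
    refine Finset.sum_congr rfl fun j _ ↦ ?_
    rw [Category.assoc, Category.assoc, freeIncl_comp_freeHom, Iso.inv_hom_id_assoc,
      Functor.map_comp]

variable {𝔪 ρ} {K N : ModuleCat.{u} R} {b : ℕ} {ι : K ⟶ freeModuleCat R b}
  {π : freeModuleCat R b ⟶ N} {w : ι ≫ π = 0} (hS : (ShortComplex.mk ι π w).ShortExact)
  (D : SocleModel 𝔪 ρ K)

variable (ι) in
/-- The lift of `ι : K ⟶ Rᵇ` to the models. -/
noncomputable def liftToFree : D.T ⟶ ⨁ fun _ : Fin b ↦ J :=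
  biproduct.lift fun j ↦ D.L (ι ≫ freeProj R j)

theorem map_comp_freeIso_hom :
    (singleFunctor (ModuleCat.{u} R) 0).map ι ≫ (freeIso ρ b).hom =
      D.φ.hom ≫ Q.map (D.liftToFree ι) := by
  change _ ≫ freeHom ρ b = _
  rw [liftToFree, biproduct.lift_eq, Functor.map_sum, Preadditive.comp_sum, freeHom,
    Preadditive.comp_sum]
  refine Finset.sum_congr rfl fun j _ ↦ ?_
  rw [Functor.map_comp, reassoc_of% (D.comm (ι ≫ freeProj R j)), Functor.map_comp, Category.assoc]

theorem liftToFree_comp_linearForm (f : freeModuleCat R b ⟶ ModuleCat.of R R) :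
    D.liftToFree ι ≫ linearForm J b f = D.L (ι ≫ f) := by
  conv_rhs => rw [eq_sum_smul_freeProj f, Preadditive.comp_sum, map_sum]
  change D.liftToFree ι ≫ (∑ j : Fin b, f.hom (Pi.single j 1) •
    biproduct.π (fun _ : Fin b ↦ J) j) = _
  rw [Preadditive.comp_sum]
  refine Finset.sum_congr rfl fun j _ ↦ ?_
  rw [Linear.comp_smul, Linear.comp_smul, map_smul, liftToFree, biproduct.lift_π]

theorem freeIso_hom_comp_linearForm (f : freeModuleCat R b ⟶ ModuleCat.of R R) :
    (freeIso ρ b).hom ≫ Q.map (linearForm J b f) =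
      (singleFunctor (ModuleCat.{u} R) 0).map f ≫ ρ.hom := by
  conv_rhs => rw [eq_sum_smul_freeProj f, Functor.map_sum, Preadditive.sum_comp]
  change freeHom ρ b ≫ Q.map (∑ j : Fin b, f.hom (Pi.single j 1) •
    biproduct.π (fun _ : Fin b ↦ J) j) = _
  rw [Functor.map_sum, Preadditive.comp_sum]
  refine Finset.sum_congr rfl fun j _ ↦ ?_
  rw [Functor.map_smul, Functor.map_smul, Linear.comp_smul, Linear.smul_comp, freeHom_comp_π]

variable (w) in
/-- The morphism induced on the mapping cone by a linear form on the cokernel of `ι`. -/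
noncomputable def coneDesc :
    (N ⟶ ModuleCat.of R R) →ₗ[R] (mappingCone (D.liftToFree ι) ⟶ J) where
  toFun f := mappingCone.desc _ 0 (linearForm J b (π ≫ f)) (by
    rw [HomComplex.δ_zero, D.liftToFree_comp_linearForm, reassoc_of% w, zero_comp, map_zero]; simp)
  map_add' f g := by
    ext p : 1
    simp [mappingCone.desc_f _ _ _ _ p (p + 1) rfl]
  map_smul' r f := by
    ext p : 1
    simp [mappingCone.desc_f _ _ _ _ p (p + 1) rfl]

theorem coneDesc_f (f : N ⟶ ModuleCat.of R R) (p : ℤ) :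
    (D.coneDesc w f).f p =
      (mappingCone.snd (D.liftToFree ι)).v p p (add_zero p) ≫ (linearForm J b (π ≫ f)).f p := by
  simp [coneDesc, mappingCone.desc_f _ _ _ _ p (p + 1) rfl]

theorem inr_comp_coneDesc (f : N ⟶ ModuleCat.of R R) :
    mappingCone.inr (D.liftToFree ι) ≫ D.coneDesc w f = linearForm J b (π ≫ f) := by
  simp [coneDesc]

/-- The isomorphism in the derived category between the cokernel of `ι` and the mapping cone. -/
noncomputable def coneIso : (singleFunctor (ModuleCat.{u} R) 0).obj N ≅
    Q.obj (mappingCone (D.liftToFree ι)) :=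
  Triangle.π₃.mapIso (isoTriangleOfIso₁₂ _ _ hS.singleTriangle_distinguished
    (mappingCone_triangle_distinguished (D.liftToFree ι)) D.φ (freeIso ρ b)
    D.map_comp_freeIso_hom)

theorem map_comp_coneIso_hom :
    (singleFunctor (ModuleCat.{u} R) 0).map π ≫ (coneIso hS D).hom =
      (freeIso ρ b).hom ≫ Q.map (mappingCone.inr (D.liftToFree ι)) :=
  (isoTriangleOfIso₁₂ _ _ hS.singleTriangle_distinguished
    (mappingCone_triangle_distinguished (D.liftToFree ι)) D.φ (freeIso ρ b)
    D.map_comp_freeIso_hom).hom.comm₂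

include hS in
theorem eq_zero_of_map_comp_eq_zero
    (d : (singleFunctor (ModuleCat.{u} R) 0).obj N ⟶
      (singleFunctor (ModuleCat.{u} R) 0).obj (ModuleCat.of R R))
    (hd : (singleFunctor (ModuleCat.{u} R) 0).map π ≫ d = 0) : d = 0 := by
  obtain ⟨g, rfl⟩ := Triangle.yoneda_exact₃ _ hS.singleTriangle_distinguished d hd
  have : TStructure.t.IsLE (((singleFunctor (ModuleCat.{u} R) 0).obj K)⟦(1 : ℤ)⟧) (-1) :=
    TStructure.t.isLE_shift _ 0 1 (-1) (by lia)
  have : g = 0 := TStructure.t.zero_of_isLE_of_isGE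
    (X := ((singleFunctor (ModuleCat.{u} R) 0).obj K)⟦(1 : ℤ)⟧) g (-1) 0 (by lia) this inferInstance
  exact (congrArg _ this).trans comp_zero

theorem coneIso_hom_comp (f : N ⟶ ModuleCat.of R R) :
    (coneIso hS D).hom ≫ Q.map (D.coneDesc w f) =
      (singleFunctor (ModuleCat.{u} R) 0).map f ≫ ρ.hom := by
  rw [← sub_eq_zero, ← Iso.cancel_iso_hom_right _ _ ρ.symm]
  refine (eq_zero_of_map_comp_eq_zero hS _ ?_).trans zero_comp.symm
  rw [Iso.symm_hom, ← Category.assoc, Preadditive.comp_sub,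
    reassoc_of% (map_comp_coneIso_hom hS D), ← Functor.map_comp, inr_comp_coneDesc,
    freeIso_hom_comp_linearForm, Functor.map_comp, Category.assoc, sub_self, zero_comp]

/-- The model of the cokernel of a morphism from a module with a model to a free module. -/
noncomputable def ofShortExact [J.IsKInjective] : SocleModel 𝔪 ρ N where
  T := mappingCone (D.liftToFree ι)
  isKInjective := by
    have := D.isKInjective
    have := isKInjective_biproduct (fun _ : Fin b ↦ J)
    exact isKInjective_mappingCone _
  φ := coneIso hS D
  L := D.coneDesc w
  comm := coneIso_hom_comp hS D
  comp_eq_zero f hf X p v hv := by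
    rw [coneDesc_f, ← Category.assoc]
    exact comp_linearForm_f_eq_zero (fun j ↦ hf _) _ fun r hr ↦ by
      rw [← Linear.smul_comp, hv r hr, zero_comp]

variable (𝔪 ρ) in
theorem nonempty_of_hasProjectiveDimensionLT [J.IsKInjective] [IsNoetherianRing R] [IsLocalRing R]
    (d : ℕ) : ∀ (N : ModuleCat.{u} R) [Module.Finite R N] [HasProjectiveDimensionLT N d],
      Nonempty (SocleModel 𝔪 ρ N) := by
  induction d using Nat.twoStepInduction with
  | zero => exact fun N _ _ ↦ ⟨ofIsZero 𝔪 ρ (isZero_of_hasProjectiveDimensionLT_zero N)⟩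
  | one =>
    intro N _ _
    have : Module.Projective R N := (IsProjective.iff_projective N).2 inferInstance
    have : Module.Free R N := Module.free_of_flat_of_isLocalRing
    let e := (Module.finBasis R N).equivFun.symm
    have h0 : IsZero (ModuleCat.of R PUnit.{u + 1}) := ModuleCat.isZero_of_subsingleton _
    have hS : (ShortComplex.mk (0 : ModuleCat.of R PUnit.{u + 1} ⟶ freeModuleCat R _)
        e.toModuleIso.hom zero_comp).ShortExact :=
      { exact := (ShortComplex.exact_iff_mono _ rfl).2
          (inferInstanceAs (Mono e.toModuleIso.hom))
        mono_f := h0.mono _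
        epi_g := inferInstanceAs (Epi e.toModuleIso.hom) }
    exact ⟨ofShortExact hS (ofIsZero 𝔪 ρ h0)⟩
  | more d _ ih =>
    intro N _ _
    obtain ⟨K, b, f, g, w, hS, hK⟩ := exists_shortExact_freeModuleCat N
    have : HasProjectiveDimensionLT K (d + 1) := hS.hasProjectiveDimensionLT_X₁ (d + 1)
      (inferInstanceAs (HasProjectiveDimensionLT (freeModuleCat R b) (d + 1))) inferInstance
    exact ⟨ofShortExact hS (ih K).some⟩

theorem comp_shift_map_eq_zero (D : SocleModel 𝔪 ρ N) {f : N ⟶ ModuleCat.of R R}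
    (hf : ∀ y, f.hom y ∈ 𝔪) {X : ModuleCat.{u} R} (hX : ∀ r ∈ 𝔪, r • 𝟙 X = 0) {n : ℤ}
    (α : (singleFunctor (ModuleCat.{u} R) 0).obj X ⟶
      ((singleFunctor (ModuleCat.{u} R) 0).obj N)⟦n⟧) :
    α ≫ ((singleFunctor (ModuleCat.{u} R) 0).map f)⟦n⟧' = 0 := by
  have := D.isKInjective
  let s := (singleFunctorIsoCompQ (ModuleCat.{u} R) 0).app X
  obtain ⟨u, hu⟩ := Q_map_surjective_of_isKInjective _ (D.T⟦n⟧)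
    (s.inv ≫ α ≫ D.φ.hom⟦n⟧' ≫ (Q.commShiftIso n).inv.app D.T)
  have hu0 : u ≫ (D.L f)⟦n⟧' = 0 := by
    ext p : 1
    refine D.comp_eq_zero f hf (u.f p) fun r hr ↦ ?_
    have : r • 𝟙 ((CochainComplex.singleFunctor (ModuleCat.{u} R) 0).obj X) = 0 := by
      rw [← CategoryTheory.Functor.map_id, ← Functor.map_smul, hX r hr, Functor.map_zero]
    have : r • u = 0 := by
      rw [← Category.id_comp u, ← Linear.smul_comp, this, zero_comp]
    exact congrArg (fun v : _ ⟶ D.T⟦n⟧ ↦ v.f p) this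
  have h : α ≫ D.φ.hom⟦n⟧' = s.hom ≫ Q.map u ≫ (Q.commShiftIso n).hom.app D.T := by
    rw [hu]; simp
  have h' : α ≫ D.φ.hom⟦n⟧' ≫ (Q.map (D.L f))⟦n⟧' = 0 := by
    rw [reassoc_of% h, ← Functor.commShiftIso_hom_naturality, ← Functor.map_comp_assoc, hu0]
    simp
  rw [← cancel_mono (ρ.hom⟦n⟧'), Category.assoc, ← Functor.map_comp, ← D.comm, Functor.map_comp,
    h', zero_comp]

end SocleModel

end SocleModels

open CategoryTheory.Limits DerivedCategory in
/-- If `𝔪` annihilates `X`, then a linear form with values in `𝔪` on a finite module of finite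
projective dimension induces zero on `Ext^i(X, -)`. -/
theorem ext_comp_mk₀_eq_zero_of_forall_mem {R : Type u} [CommRing R] [IsNoetherianRing R]
    [IsLocalRing R] {𝔪 : Ideal R} {X N : ModuleCat.{u} R} (hX : ∀ r ∈ 𝔪, r • 𝟙 X = 0)
    [Module.Finite R N] {d : ℕ} [HasProjectiveDimensionLT N d] {i : ℕ} (e : Abelian.Ext X N i)
    (f : N ⟶ ModuleCat.of R R) (hf : ∀ y, f.hom y ∈ 𝔪) :
    e.comp (Ext.mk₀ f) (add_zero i) = 0 := by
  let := HasDerivedCategory.standard (ModuleCat.{u} R)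
  let I := injectiveResolution (ModuleCat.of R R)
  let ρ : (singleFunctor (ModuleCat.{u} R) 0).obj (ModuleCat.of R R) ≅ Q.obj I.cochainComplex :=
    (singleFunctorIsoCompQ _ 0).app _ ≪≫ asIso (Q.map I.ι')
  obtain ⟨D⟩ := SocleModel.nonempty_of_hasProjectiveDimensionLT 𝔪 ρ d N
  ext
  rw [Ext.comp_hom, Ext.mk₀_hom, Ext.zero_hom, ShiftedHom.comp_mk₀]
  exact D.comp_shift_map_eq_zero hf hX e.hom

theorem ext_residueField_comp_eq_zero {R : Type u} [CommRing R] [IsNoetherianRing R]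
    [IsLocalRing R] {N : ModuleCat.{u} R} [Module.Finite R N] {d : ℕ}
    [HasProjectiveDimensionLT N d] {i : ℕ}
    (e : Abelian.Ext (ModuleCat.of R (R ⧸ IsLocalRing.maximalIdeal R)) N i)
    (f : N ⟶ ModuleCat.of R R) (hf : ∀ y, f.hom y ∈ IsLocalRing.maximalIdeal R) :
    e.comp (Ext.mk₀ f) (add_zero i) = 0 := by
  refine ext_comp_mk₀_eq_zero_of_forall_mem (d := d)
    (fun r hr ↦ ModuleCat.hom_ext (LinearMap.ext fun x ↦ ?_))
    e f hf
  obtain ⟨y, rfl⟩ := Ideal.Quotient.mk_surjective x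
  exact Ideal.Quotient.eq_zero_iff_mem.2 (Ideal.mul_mem_right y _ hr)

theorem IsGorensteinRing.exists_module {R : Type} [CommRing R] [Nontrivial R]
    (hR : IsGorensteinRing R) :
    ∃ M : ModuleCat R, Nontrivial M ∧ Module.Finite R M ∧
      (∃ n : ℕ, injDimLE R M n) ∧ auslanderBound R M ≠ ⊤ ∧
      (∃ n : ℕ, ∀ i : ℕ, n < i → extVanish R M (ModuleCat.of R R) i) := by
  have hzero (N : ModuleCat R) (i : ℕ) (hi : 0 < i) :
      Subsingleton (Abelian.Ext (ModuleCat.of R R) N i) :=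
    have : Projective (ModuleCat.of R R) := inferInstance
    match i, hi with
    | i + 1, _ => subsingleton_of_forall_eq 0 fun e ↦ e.eq_zero_of_projective
  refine ⟨ModuleCat.of R R, ‹Nontrivial R›, inferInstanceAs (Module.Finite R R), hR,
    ne_top_of_le_ne_top (ENat.natCast_ne_top 0) (sSup_le ?_),
    0, fun i hi ↦ (extVanish_iff_of_pos R _ _ hi).2 (hzero _ i hi)⟩
  rintro _ ⟨N, -, -, -, rfl⟩
  exact (extSup_le_iff _ _ _ _).2 (hzero N)

section AuslanderBound

variable {R : Type} [CommRing R]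

theorem subsingleton_ext_of_auslanderBound_le {M : ModuleCat.{0} R} {b : ℕ}
    (hb : auslanderBound R M ≤ b) (Y : ModuleCat R) [Module.Finite R Y]
    (hY : ∃ n, ∀ i, n < i → Subsingleton (Abelian.Ext M Y i)) (i : ℕ) (hi : b < i) :
    Subsingleton (Abelian.Ext M Y i) := by
  rcases subsingleton_or_nontrivial Y with hY₀ | hY₀
  · have hz : Limits.IsZero Y := ModuleCat.isZero_of_subsingleton _
    refine subsingleton_of_forall_eq 0 fun e ↦ ?_
    rw [← e.comp_mk₀_id, hz.eq_of_src (𝟙 _) 0, Ext.mk₀_zero, Ext.comp_zero]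
  · obtain ⟨n, hn⟩ := hY
    have hfin : extSup R M Y ≠ ⊤ :=
      ne_top_of_le_ne_top (ENat.natCast_ne_top n) ((extSup_le_iff R M Y n).2 hn)
    have hle : extSup R M Y ≤ auslanderBound R M := le_sSup ⟨Y, ‹_›, hY₀, hfin, rfl⟩
    exact (extSup_le_iff R M Y b).1 (hle.trans hb) i hi

theorem exists_hasProjectiveDimensionLE [IsNoetherianRing R] {M : ModuleCat.{0} R}
    [Module.Finite R M] {n : ℕ} [HasInjectiveDimensionLE M n] (hb : auslanderBound R M ≠ ⊤)
    (hR : ∃ n, ∀ i, n < i → Subsingleton (Abelian.Ext M (ModuleCat.of R R) i)) :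
    ∃ d, HasProjectiveDimensionLE M d := by
  obtain ⟨b, hb⟩ := ENat.ne_top_iff_exists.1 hb
  refine ⟨b, hasProjectiveDimensionLE_of_subsingleton_ext
    (fun Y ↦ ∃ n, ∀ i, n < i → Subsingleton (Abelian.Ext M Y i)) ?_ b M ?_ ?_⟩
  · rintro K c f L g w hS ⟨m, hm⟩
    obtain ⟨l, hl⟩ := hR
    refine ⟨max m l + 1, fun i hi ↦ ?_⟩
    obtain ⟨i, rfl⟩ := Nat.exists_eq_succ_of_ne_zero (by lia : i ≠ 0)
    have := hm i (by lia)
    have := hl (i + 1) (by lia)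
    have := subsingleton_ext_freeModuleCat (X := M) (i := i + 1) c
    exact hS.subsingleton_ext_right_X₁ M i
  · exact ⟨n, fun i hi ↦ subsingleton_of_forall_eq 0 fun e ↦
      e.eq_zero_of_hasInjectiveDimensionLT (n + 1) (by lia)⟩
  · intro Y _ hY
    exact subsingleton_ext_of_auslanderBound_le hb.ge Y hY (b + 1) (by lia)

end AuslanderBound

theorem IsGorensteinRing.of_module {R : Type} [CommRing R] [IsNoetherianRing R] [IsLocalRing R]
    {M : ModuleCat.{0} R} [Nontrivial M] [Module.Finite R M]
    {n d : ℕ} [HasInjectiveDimensionLE M n] [HasProjectiveDimensionLE M d] :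
    IsGorensteinRing R := by
  let k := ModuleCat.of R (R ⧸ IsLocalRing.maximalIdeal R)
  obtain ⟨K, b, f, g, w, hS, hK, hb, hf⟩ := exists_shortExact_minimal M
  have hKd : HasProjectiveDimensionLT K (d + 1) :=
    hS.hasProjectiveDimensionLT_X₁ (d + 1)
      (inferInstanceAs (HasProjectiveDimensionLT (freeModuleCat R b) (d + 1)))
      (hasProjectiveDimensionLT_of_ge M (d + 1) (d + 2) (by lia))
  have hvan (i : ℕ) (hi : n < i) : Subsingleton (Abelian.Ext k (ModuleCat.of R R) i) := by
    refine subsingleton_of_forall_eq 0 fun e ↦ ?_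
    obtain ⟨e', he'⟩ := Ext.covariant_sequence_exact₂ k hS
      (e.comp (Ext.mk₀ (freeIncl R ⟨0, hb⟩)) (add_zero i))
      (Ext.eq_zero_of_hasInjectiveDimensionLT _ (n + 1) (by lia))
    have := congrArg (fun a ↦ a.comp (Ext.mk₀ (freeProj R ⟨0, hb⟩)) (add_zero i)) he'
    dsimp only at this
    rw [Ext.comp_assoc_of_third_deg_zero, Ext.comp_assoc_of_third_deg_zero, Ext.mk₀_comp_mk₀,
      Ext.mk₀_comp_mk₀, freeIncl_comp_freeProj_self, Ext.comp_mk₀_id,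
      ext_residueField_comp_eq_zero (d := d + 1) e' (f ≫ freeProj R ⟨0, hb⟩) (hf _)] at this
    exact this.symm
  refine ⟨n, (injDimLE_iff R _ n).2 (hasInjectiveDimensionLE_of_subsingleton_ext_quotient _ n
    fun I ↦ ?_)⟩
  exact subsingleton_ext_quotient_of_residueField _ n hvan I (n + 1) (by lia)

theorem gorenstein_iff_exists_module_finite_injDim_auslanderBound
    (R : Type) [CommRing R] [IsNoetherianRing R] [IsLocalRing R] :
    IsGorensteinRing R ↔
      ∃ M : ModuleCat R, Nontrivial M ∧ Module.Finite R M ∧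
        (∃ n : ℕ, injDimLE R M n) ∧
        auslanderBound R M ≠ ⊤ ∧
        (∃ n : ℕ, ∀ i : ℕ, n < i → extVanish R M (ModuleCat.of R R) i) := by
  refine ⟨IsGorensteinRing.exists_module, ?_⟩
  rintro ⟨M, _, _, ⟨n, hn⟩, hb, m, hm⟩
  have := (injDimLE_iff R M n).1 hn
  obtain ⟨d, _⟩ := exists_hasProjectiveDimensionLE (n := n) hb
    ⟨m, fun i hi ↦ (extVanish_iff_of_pos R _ _ (by lia)).1 (hm i hi)⟩
  exact IsGorensteinRing.of_module (M := M) (n := n) (d := d)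
end

section
/- Let R be a commutative Noetherian local ring. If there exists a nonzero maximal Cohen-Macaulay R-module M with finite injective dimension, finite Auslander bound B(M), and Ext^i_R(M,R) = 0 for all i > 0, then R is Gorenstein. -/
/-!
STATEMENT 15: Let `R` be a commutative Noetherian local ring.  If there exists a nonzero
maximal Cohen-Macaulay `R`-module `M` (i.e. `depth M = dim R`) with finite injective
dimension, finite Auslander bound `B(M)`, and `Ext^i_R(M,R) = 0` for all `i > 0`, then
`R` is Gorenstein.
-/

open CategoryTheory

/-- The depth of a module `M` over a Noetherian local ring: the least `i` such that
`Ext^i_R(k, M) ≠ 0`, where `k` is the residue field. -/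
noncomputable def depthE (R : Type) [CommRing R] [IsLocalRing R] (M : ModuleCat R) : ℕ∞ :=
  sInf {c : ℕ∞ | ∃ i : ℕ, c = i ∧
    ¬ extVanish R (ModuleCat.of R (IsLocalRing.ResidueField R)) M i}

open Abelian

/-- A degreewise description of the vanishing of the derived functor `Ext` in positive degree. -/
lemma extVanish_succ_iff_s15 {R : Type} [CommRing R] {M N : ModuleCat R}
    (P : ProjectiveResolution M) (n : ℕ) :
    extVanish R M N (n + 1) ↔
      ∀ f : P.complex.X (n + 1) ⟶ N, P.complex.d (n + 2) (n + 1) ≫ f = 0 →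
        ∃ g : P.complex.X n ⟶ N, P.complex.d (n + 1) n ≫ g = f := by
  rw [extVanish, extRMod, ← ModuleCat.isZero_iff_subsingleton,
    (P.isoExt (R := R) (n + 1) N).isZero_iff, ← HomologicalComplex.exactAt_iff_isZero_homology,
    HomologicalComplex.exactAt_iff' _ n (n + 1) (n + 2) (by simp) (by simp),
    ShortComplex.moduleCat_exact_iff]
  rfl

/-- The derived functor `Ext` and the `Ext`-groups defined through the derived category vanish
simultaneously in positive degree. -/
lemma extVanish_succ_iff_subsingleton_ext {R : Type} [CommRing R] {M N : ModuleCat R} (n : ℕ) :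
    extVanish R M N (n + 1) ↔ Subsingleton (Ext M N (n + 1)) := by
  let P := projectiveResolution M
  rw [extVanish_succ_iff_s15 P]
  constructor
  · intro h
    refine subsingleton_of_forall_eq 0 fun α ↦ ?_
    obtain ⟨f, hf, rfl⟩ := P.extMk_surjective α (n + 2) rfl
    exact (P.extMk_eq_zero_iff f (n + 2) rfl hf n rfl).2 (h f hf)
  · intro h f hf
    exact (P.extMk_eq_zero_iff f (n + 2) rfl hf n rfl).1 (Subsingleton.elim _ _)

lemma extVanish_iff_subsingleton_ext {R : Type} [CommRing R] {M N : ModuleCat R} {n : ℕ}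
    (hn : 0 < n) : extVanish R M N n ↔ Subsingleton (Ext M N n) := by
  obtain ⟨n, rfl⟩ := Nat.exists_eq_succ_of_ne_zero hn.ne'
  exact extVanish_succ_iff_subsingleton_ext n

namespace CategoryTheory.Abelian.Ext

universe w v u

variable {C : Type u} [Category.{v} C] [Abelian C] [HasExt.{w} C]

/-- Dimension shifting along a short exact sequence whose middle term has no `Ext` from `X`. -/
lemma subsingleton_iff_of_shortExact (X : C) {S : ShortComplex C} (hS : S.ShortExact) {n : ℕ}
    (h : Subsingleton (Ext X S.X₂ n)) (h' : Subsingleton (Ext X S.X₂ (n + 1))) :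
    Subsingleton (Ext X S.X₁ (n + 1)) ↔ Subsingleton (Ext X S.X₃ n) := by
  constructor <;> refine fun _ ↦ subsingleton_of_forall_eq 0 fun x ↦ ?_
  · obtain ⟨y, rfl⟩ := covariant_sequence_exact₃ X hS x rfl (Subsingleton.elim _ _)
    rw [Subsingleton.elim y 0, zero_comp]
  · obtain ⟨y, rfl⟩ := covariant_sequence_exact₁ X hS x (Subsingleton.elim _ _) rfl
    rw [Subsingleton.elim y 0, zero_comp]

/-- A short exact sequence ending in `X` splits if `Ext¹` from `X` to its first term vanishes. -/
lemma exists_section_of_subsingleton {S : ShortComplex C} (hS : S.ShortExact)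
    (h : Subsingleton (Ext S.X₃ S.X₁ 1)) : ∃ s : S.X₃ ⟶ S.X₂, s ≫ S.g = 𝟙 S.X₃ := by
  obtain ⟨x, hx⟩ := covariant_sequence_exact₃ S.X₃ hS (mk₀ (𝟙 S.X₃)) (zero_add 1)
    (Subsingleton.elim _ _)
  obtain ⟨s, rfl⟩ := addEquiv₀.symm.surjective x
  refine ⟨s, addEquiv₀.symm.injective ?_⟩
  simpa using hx

lemma subsingleton_of_retract (X : C) {Y Z : C} (r : Retract Y Z) (n : ℕ)
    (h : Subsingleton (Ext X Z n)) : Subsingleton (Ext X Y n) := by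
  refine subsingleton_of_forall_eq 0 fun x ↦ ?_
  rw [← x.comp_mk₀_id, ← r.retract, ← mk₀_comp_mk₀, ← comp_assoc_of_third_deg_zero,
    Subsingleton.elim (x.comp (mk₀ r.i) (add_zero n)) 0, zero_comp]

lemma subsingleton_pi {R : Type} [CommRing R] {M : ModuleCat R} {n : ℕ}
    (h : Subsingleton (Ext M (ModuleCat.of R R) n)) (ι : Type) [Fintype ι] :
    Subsingleton (Ext M (ModuleCat.of R (ι → R)) n) := by
  classical
  refine subsingleton_of_forall_eq 0 fun x ↦ ?_
  have hid : 𝟙 (ModuleCat.of R (ι → R)) = ∑ i : ι,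
      ModuleCat.ofHom (LinearMap.proj (R := R) (φ := fun _ : ι ↦ R) i) ≫
        ModuleCat.ofHom (LinearMap.single R (fun _ : ι ↦ R) i) := by
    ext : 1
    refine LinearMap.ext fun v ↦ funext fun j ↦ ?_
    simp [ModuleCat.hom_sum, LinearMap.sum_apply, Finset.sum_apply, Pi.single_apply]
  rw [← x.comp_mk₀_id, hid, mk₀_sum, comp_sum]
  refine Finset.sum_eq_zero fun i _ ↦ ?_
  rw [← mk₀_comp_mk₀, ← comp_assoc_of_third_deg_zero,
    Subsingleton.elim (x.comp (mk₀ _) (add_zero n)) 0, zero_comp]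

/-- Finitely generated modules over a Noetherian ring have finitely generated higher syzygies,
which shift `Ext` from a module `M` with `Extⁱ(M, R) = 0` for all `i > 0`. -/
lemma exists_finite_shift {R : Type} [CommRing R] [IsNoetherianRing R] {M : ModuleCat R}
    (hM : ∀ i, 0 < i → Subsingleton (Ext M (ModuleCat.of R R) i))
    (N : ModuleCat R) [Module.Finite R N] (j : ℕ) :
    ∃ K : ModuleCat R, Module.Finite R K ∧
      ∀ i, 0 < i → (Subsingleton (Ext M K (i + j)) ↔ Subsingleton (Ext M N i)) := by
  induction j with
  | zero => exact ⟨N, inferInstance, fun i _ ↦ Iff.rfl⟩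
  | succ j ih =>
    obtain ⟨K, _, hK⟩ := ih
    obtain ⟨k, f, hf⟩ := Module.Finite.exists_fin' R K
    refine ⟨ModuleCat.of R (LinearMap.ker f), inferInstance, fun i hi ↦ ?_⟩
    rw [← hK i hi]
    exact subsingleton_iff_of_shortExact M (LinearMap.shortExact_shortComplexKer hf)
      (subsingleton_pi (hM _ (by lia)) _) (subsingleton_pi (hM _ (by lia)) _)

end CategoryTheory.Abelian.Ext

lemma extSup_ne_top {R : Type} [CommRing R] {M N : ModuleCat R} {n : ℕ}
    (h : ∀ i, n < i → extVanish R M N i) : extSup R M N ≠ ⊤ := by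
  refine ne_top_of_le_ne_top (ENat.natCast_ne_top n) (sSup_le ?_)
  rintro _ ⟨i, rfl, hi⟩
  by_contra hlt
  exact hi (h i (by simpa using hlt))

lemma extVanish_of_auslanderBound_lt {R : Type} [CommRing R] {M N : ModuleCat R}
    [Module.Finite R N] (hN : extSup R M N ≠ ⊤) {i : ℕ} (hi : 0 < i)
    (hlt : auslanderBound R M < i) : extVanish R M N i := by
  rcases subsingleton_or_nontrivial N with h | h
  · rw [extVanish_iff_subsingleton_ext hi]
    refine subsingleton_of_forall_eq 0 fun x ↦ ?_
    rw [← x.comp_mk₀_id, (ModuleCat.isZero_of_subsingleton N).eq_of_src (𝟙 N) 0, Ext.mk₀_zero,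
      Ext.comp_zero]
  · by_contra hne
    refine hlt.not_ge ((le_sSup ⟨i, rfl, hne⟩ : (i : ℕ∞) ≤ extSup R M N).trans ?_)
    exact le_sSup ⟨N, inferInstance, h, hN, rfl⟩

/-- A finitely generated module `M` over a Noetherian ring with finite Auslander bound and with
`Extⁱ(M, R) = 0` for `i > 0`, `Extⁱ(M, M) = 0` for `i ≫ 0` is projective. -/
lemma projective_of_auslanderBound_ne_top {R : Type} [CommRing R] [IsNoetherianRing R]
    {M : ModuleCat R} [Module.Finite R M] (hB : auslanderBound R M ≠ ⊤)
    (hext : ∀ i : ℕ, 0 < i → extVanish R M (ModuleCat.of R R) i)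
    {n : ℕ} (hself : ∀ i : ℕ, n < i → extVanish R M M i) : Module.Projective R M := by
  have hR : ∀ i, 0 < i → Subsingleton (Ext M (ModuleCat.of R R) i) := fun i hi ↦
    (extVanish_iff_subsingleton_ext hi).1 (hext i hi)
  obtain ⟨b, hb⟩ := ENat.ne_top_iff_exists.1 hB
  obtain ⟨k, f, hf⟩ := Module.Finite.exists_fin' R M
  have hS := LinearMap.shortExact_shortComplexKer hf
  obtain ⟨K, _, hK⟩ := Ext.exists_finite_shift hR (ModuleCat.of R (LinearMap.ker f)) b
  have hsup : extSup R M K ≠ ⊤ := by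
    refine extSup_ne_top (n := n + 1 + b) fun i hi ↦ ?_
    obtain ⟨j, rfl⟩ : ∃ j, i = j + 1 + b := ⟨i - 1 - b, by lia⟩
    rw [extVanish_iff_subsingleton_ext (by lia), hK (j + 1) (by lia)]
    refine (Ext.subsingleton_iff_of_shortExact M hS (Ext.subsingleton_pi (hR _ (by lia)) _)
      (Ext.subsingleton_pi (hR _ (by lia)) _)).2 ?_
    exact (extVanish_iff_subsingleton_ext (by lia)).1 (hself j (by lia))
  have hvan : extVanish R M K (1 + b) := extVanish_of_auslanderBound_lt hsup (by lia) (by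
    rw [← hb]
    exact_mod_cast (by lia : b < 1 + b))
  rw [extVanish_iff_subsingleton_ext (by lia), hK 1 one_pos] at hvan
  obtain ⟨s, hs⟩ := Ext.exists_section_of_subsingleton hS hvan
  exact Module.Projective.of_split s.hom f (congrArg ModuleCat.Hom.hom hs)

/-- Over a local ring `R`, the module `R` is a retract of each nonzero finite projective module. -/
lemma exists_retract_of_projective {R : Type} [CommRing R] [IsLocalRing R]
    (M : ModuleCat R) [Nontrivial M] [Module.Finite R M] [Module.Projective R M] :
    Nonempty (Retract (ModuleCat.of R R) M) := by
  have : Module.Free R M := Module.free_of_flat_of_isLocalRing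
  let b := Module.Free.chooseBasis R M
  obtain ⟨i⟩ := b.index_nonempty
  refine ⟨⟨ModuleCat.ofHom (LinearMap.toSpanSingleton R M (b i)), ModuleCat.ofHom (b.coord i), ?_⟩⟩
  ext
  simp

theorem gorenstein_of_MCM_finite_injDim_auslanderBound
    (R : Type) [CommRing R] [IsNoetherianRing R] [IsLocalRing R]
    (M : ModuleCat R) (hM : Nontrivial M) (hfg : Module.Finite R M)
    (hMCM : (depthE R M : WithBot ℕ∞) = ringKrullDim R)
    (hinj : ∃ n : ℕ, injDimLE R M n)
    (hB : auslanderBound R M ≠ ⊤)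
    (hext : ∀ i : ℕ, 0 < i → extVanish R M (ModuleCat.of R R) i) :
    IsGorensteinRing R := by
  obtain ⟨n, hn⟩ := hinj
  have := projective_of_auslanderBound_ne_top hB hext (hn M)
  obtain ⟨r⟩ := exists_retract_of_projective M
  refine ⟨n, fun N i hi ↦ ?_⟩
  have hi' : 0 < i := by lia
  rw [extVanish_iff_subsingleton_ext hi']
  exact Ext.subsingleton_of_retract N r i ((extVanish_iff_subsingleton_ext hi').1 (hn N i hi))
end
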